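/- Let U and W be concave order isomorphisms of ℝ and suppose U = r ∘ W for an increasing concave function r : ℝ → ℝ (i.e., U is more risk averse than W). Then for every horizon N ≥ 1, every 0 ≤ n ≤ N − 1 and every information state μ ∈ I, the corresponding reservation levels satisfy x_{n,N}(μ; U) ≤ x_{n,N}(μ; W); that is, a more risk-averse decision maker has lower reservation levels. -/

import Mathlib

open MeasureTheory ProbabilityTheory

/-- The reservation levels of the general-utility house selling problem, indexed by the
number of extra remaining stages and the current time stage: `resvLevel Q Φ c U k n μ` is
the reservation level `x_{n, N}(μ)` for the horizon `N = n + k + 1`.  With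
`U_n(x) = U(x − n·c)` and `U_n⁻¹(y) = n·c + U⁻¹(y)`, the backward recursion reads
`x_{N−1,N}(μ) = U_{N−1}⁻¹(∫ U_N(x) Q(μ,dx))` and
`x_{n,N}(μ) = U_n⁻¹(∫ U_{n+1}(max{x, x_{n+1,N}(Φ(x,μ))}) Q(μ,dx))`. -/
noncomputable def resvLevel {I : Type*} [MeasurableSpace I]
    (Q : Kernel I ℝ) (Φ : ℝ → I → I) (c : ℝ) (U : ℝ ≃o ℝ) : ℕ → ℕ → I → ℝ
  | 0, n, μ => (n : ℝ) * c + U.symm (∫ x, U (x - ((n : ℝ) + 1) * c) ∂(Q μ))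
  | k + 1, n, μ => (n : ℝ) * c + U.symm (∫ x,
      U (max x (resvLevel Q Φ c U k (n + 1) (Φ x μ)) - ((n : ℝ) + 1) * c) ∂(Q μ))

/-- An order isomorphism of `ℝ` composed with an a.e. bounded measurable function is integrable. -/
theorem OrderIso.integrable_comp_of_ae_mem_Icc {Ω : Type*} [MeasurableSpace Ω] {P : Measure Ω}
    [IsFiniteMeasure P] (V : ℝ ≃o ℝ) {g : Ω → ℝ} (hg : Measurable g) {a d : ℝ}
    (hgm : ∀ᵐ x ∂P, g x ∈ Set.Icc a d) : Integrable (fun x => V (g x)) P :=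
  Integrable.of_mem_Icc (V a) (V d) (V.continuous.measurable.comp hg).aemeasurable
    (hgm.mono fun _ hx => ⟨V.monotone hx.1, V.monotone hx.2⟩)

/-- The certainty equivalent of a random variable is at most any upper bound for it. -/
theorem OrderIso.symm_integral_comp_le {Ω : Type*} [MeasurableSpace Ω] {P : Measure Ω}
    [IsProbabilityMeasure P] (V : ℝ ≃o ℝ) {g : Ω → ℝ} (hg : Measurable g) {a d : ℝ}
    (hgm : ∀ᵐ x ∂P, g x ∈ Set.Icc a d) : V.symm (∫ x, V (g x) ∂P) ≤ d := by
  rw [V.symm_apply_le]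
  simpa using integral_mono_ae (V.integrable_comp_of_ae_mem_Icc hg hgm) (integrable_const (V d))
    (hgm.mono fun _ hx => V.monotone hx.2)

/-- Certainty equivalents decrease in risk aversion and increase in the random variable. -/
theorem OrderIso.symm_integral_comp_le_of_concave_comp {Ω : Type*} [MeasurableSpace Ω]
    {P : Measure Ω} [IsProbabilityMeasure P] {U W : ℝ ≃o ℝ} {r : ℝ → ℝ}
    (hr : ConcaveOn ℝ _root_.Set.univ r) (hUrW : ∀ x, U x = r (W x))
    {g h : Ω → ℝ} (hg : Measurable g) (hh : Measurable h) {a d : ℝ}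
    (hgm : ∀ᵐ x ∂P, g x ∈ Set.Icc a d) (hhm : ∀ᵐ x ∂P, h x ∈ Set.Icc a d)
    (hgh : ∀ x, g x ≤ h x) :
    U.symm (∫ x, U (g x) ∂P) ≤ W.symm (∫ x, W (h x) ∂P) := by
  rw [U.symm_apply_le, hUrW, W.apply_symm_apply]
  have hrc : Continuous r := by
    have : r = U ∘ W.symm := funext fun y => by simp [hUrW]
    exact this ▸ U.continuous.comp W.symm.continuous
  have hU := U.integrable_comp_of_ae_mem_Icc hh hhm
  calc ∫ x, U (g x) ∂P ≤ ∫ x, U (h x) ∂P :=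
        integral_mono (U.integrable_comp_of_ae_mem_Icc hg hgm) hU fun x => U.monotone (hgh x)
    _ = ∫ x, r (W (h x)) ∂P := by simp only [hUrW]
    _ ≤ r (∫ x, W (h x) ∂P) := by
        refine hr.le_map_integral hrc.continuousOn isClosed_univ (by simp)
          (W.integrable_comp_of_ae_mem_Icc hh hhm) ?_
        simpa only [hUrW, Function.comp_def] using hU

section ResvLevel

variable {I : Type*} [MeasurableSpace I] {Q : Kernel I ℝ} {m b : ℝ} {Φ : ℝ → I → I} {c : ℝ}

theorem ae_max_sub_mem_Icc {P : Measure ℝ} (hP : ∀ᵐ x ∂P, x ∈ Set.Icc m b) {f : ℝ → ℝ}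
    (hf : ∀ x, f x ≤ b) (t : ℝ) :
    ∀ᵐ x ∂P, max x (f x) - t ∈ Set.Icc (m - t) (b - t) :=
  hP.mono fun x hx => ⟨sub_le_sub_right (hx.1.trans (le_max_left _ _)) t,
    sub_le_sub_right (max_le hx.2 (hf x)) t⟩

theorem ae_sub_mem_Icc {P : Measure ℝ} (hP : ∀ᵐ x ∂P, x ∈ Set.Icc m b) (t : ℝ) :
    ∀ᵐ x ∂P, x - t ∈ Set.Icc (m - t) (b - t) :=
  hP.mono fun _ hx => ⟨sub_le_sub_right hx.1 t, sub_le_sub_right hx.2 t⟩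

/-- Reservation levels never exceed the largest possible offer. -/
theorem resvLevel_le [IsMarkovKernel Q] (hQ : ∀ μ, ∀ᵐ x ∂(Q μ), x ∈ Set.Icc m b) (hc : 0 ≤ c)
    {V : ℝ ≃o ℝ}
    (hmeas : ∀ (k n : ℕ) (μ : I), Measurable fun x => resvLevel Q Φ c V k (n + 1) (Φ x μ))
    (k n : ℕ) (μ : I) : resvLevel Q Φ c V k n μ ≤ b := by
  induction k generalizing n μ with
  | zero =>
    have := V.symm_integral_comp_le (measurable_id.sub_const _)
      (ae_sub_mem_Icc (hQ μ) (((n : ℝ) + 1) * c))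
    simp only [resvLevel, id] at this ⊢
    linarith
  | succ k ih =>
    have := V.symm_integral_comp_le ((measurable_id.max (hmeas k n μ)).sub_const _)
      (ae_max_sub_mem_Icc (hQ μ) (fun x => ih (n + 1) (Φ x μ)) (((n : ℝ) + 1) * c))
    simp only [resvLevel, id] at this ⊢
    linarith

/-- Reservation levels decrease in risk aversion, indexed by the number of remaining stages. -/
theorem resvLevel_le_of_concave_comp [IsMarkovKernel Q]
    (hQ : ∀ μ, ∀ᵐ x ∂(Q μ), x ∈ Set.Icc m b) (hc : 0 ≤ c) {U W : ℝ ≃o ℝ}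
    (hmeasU : ∀ (k n : ℕ) (μ : I), Measurable fun x => resvLevel Q Φ c U k (n + 1) (Φ x μ))
    (hmeasW : ∀ (k n : ℕ) (μ : I), Measurable fun x => resvLevel Q Φ c W k (n + 1) (Φ x μ))
    {r : ℝ → ℝ} (hr : ConcaveOn ℝ Set.univ r) (hUrW : ∀ x, U x = r (W x))
    (k n : ℕ) (μ : I) : resvLevel Q Φ c U k n μ ≤ resvLevel Q Φ c W k n μ := by
  induction k generalizing n μ with
  | zero =>
    have h := ae_sub_mem_Icc (hQ μ) (((n : ℝ) + 1) * c)
    have hid : Measurable fun x : ℝ => x - ((n : ℝ) + 1) * c := measurable_id.sub_const _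
    simp only [resvLevel]
    gcongr
    exact OrderIso.symm_integral_comp_le_of_concave_comp hr hUrW hid hid h h fun _ => le_rfl
  | succ k ih =>
    simp only [resvLevel]
    gcongr
    exact OrderIso.symm_integral_comp_le_of_concave_comp hr hUrW
      ((measurable_id.max (hmeasU k n μ)).sub_const _)
      ((measurable_id.max (hmeasW k n μ)).sub_const _)
      (ae_max_sub_mem_Icc (hQ μ) (fun x => resvLevel_le hQ hc hmeasU k (n + 1) (Φ x μ)) _)
      (ae_max_sub_mem_Icc (hQ μ) (fun x => resvLevel_le hQ hc hmeasW k (n + 1) (Φ x μ)) _)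
      fun x => sub_le_sub_right (max_le_max le_rfl (ih (n + 1) (Φ x μ))) _

end ResvLevel

/-- A more risk-averse decision maker has lower reservation levels: if `U = r ∘ W` for an
increasing concave `r` (i.e. `U` is more risk averse than `W`), then for every horizon
`N ≥ 1`, every `0 ≤ n ≤ N − 1` and every information state `μ`,
`x_{n,N}(μ; U) ≤ x_{n,N}(μ; W)`  (here `x_{n,N}(·; U) = resvLevel Q Φ c U (N − 1 − n) n`). -/
theorem reservation_levels_decreasing_in_risk_aversion
    {I : Type*} [MeasurableSpace I]
    (Q : Kernel I ℝ) [IsMarkovKernel Q]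
    (m b : ℝ) (hmb : m ≤ b) (hsupp : ∀ μ : I, Q μ (Set.Icc m b)ᶜ = 0)
    (Φ : ℝ → I → I) (hΦ : Measurable (Function.uncurry Φ))
    (c : ℝ) (hc : 0 < c)
    (U W : ℝ ≃o ℝ) (hUconc : ConcaveOn ℝ Set.univ U) (hWconc : ConcaveOn ℝ Set.univ W)
    (hmeasU : ∀ (k n : ℕ) (μ : I),
      Measurable fun x => resvLevel Q Φ c U k (n + 1) (Φ x μ))
    (hmeasW : ∀ (k n : ℕ) (μ : I),
      Measurable fun x => resvLevel Q Φ c W k (n + 1) (Φ x μ))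
    (r : ℝ → ℝ) (hr : Monotone r) (hrconc : ConcaveOn ℝ Set.univ r)
    (hUrW : ∀ x : ℝ, U x = r (W x)) :
    ∀ (N n : ℕ) (μ : I), 1 ≤ N → n ≤ N - 1 →
      resvLevel Q Φ c U (N - 1 - n) n μ ≤ resvLevel Q Φ c W (N - 1 - n) n μ := by
  intro N n μ _ _
  exact resvLevel_le_of_concave_comp (fun μ => mem_ae_iff.mpr (hsupp μ)) hc.le hmeasU hmeasW
    hrconc hUrW (N - 1 - n) n μ
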